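/- arXiv:1405.5190 — 2 statements merged into one kernel-verified Lean document; each statement's English description precedes it below -/
import Mathlib

section
/- Let n ≥ 2 and let f : ℝ_{>0}^n → ℝ_{>0} be a quasi-sum production function, f(x_1,…,x_n) = G(h_1(x_1)+…+h_n(x_n)), where G and the h_j are twice differentiable strictly monotone real functions with G' > 0. If, for some fixed index i, the elasticity of production with respect to x_i is a nonzero constant k_i (i.e. (x_i/f(x))·∂f/∂x_i(x) = k_i for all x), then there exist positive constants C and D such that G(u) = C·e^{D·u} for all u in the range of h_1(x_1)+…+h_n(x_n). -/
/-- Partial derivative of `f : ℝⁿ → ℝ` with respect to the `i`-th coordinate at `x`. -/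
noncomputable def pd {n : ℕ} (f : (Fin n → ℝ) → ℝ) (i : Fin n) (x : Fin n → ℝ) : ℝ :=
  deriv (fun t => f (Function.update x i t)) (x i)

/-- A continuous strictly monotone or strictly antitone function on `(0, ∞)` has a neighbourhood of
each of its values as image. -/
theorem image_Ioi_mem_nhds {g : ℝ → ℝ} (hc : ContinuousOn g (Set.Ioi 0))
    (hm : StrictMonoOn g (Set.Ioi 0) ∨ StrictAntiOn g (Set.Ioi 0)) {t : ℝ} (ht : 0 < t) :
    g '' Set.Ioi 0 ∈ nhds (g t) := by
  have h0 : 0 < t / 2 := by linarith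
  have hsub : Set.Icc (t / 2) (t + 1) ⊆ Set.Ioi (0 : ℝ) := fun s hs => h0.trans_le hs.1
  have ha : t / 2 ∈ Set.Ioi (0 : ℝ) := h0
  have hb : t + 1 ∈ Set.Ioi (0 : ℝ) := by simp only [Set.mem_Ioi]; linarith
  have hat : t / 2 < t := by linarith
  have htb : t < t + 1 := by linarith
  have hle : t / 2 ≤ t + 1 := by linarith
  rcases hm with hm | hm
  · exact Filter.mem_of_superset (Icc_mem_nhds (hm ha ht hat) (hm ht hb htb))
      ((intermediate_value_Icc hle (hc.mono hsub)).trans (Set.image_mono hsub))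
  · exact Filter.mem_of_superset (Icc_mem_nhds (hm ht hb htb) (hm ha ht hat))
      ((intermediate_value_Icc' hle (hc.mono hsub)).trans (Set.image_mono hsub))

theorem sum_apply_update {n : ℕ} (h : Fin n → ℝ → ℝ) (x : Fin n → ℝ) (j : Fin n) (t : ℝ) :
    ∑ k, h k (Function.update x j t k) = ∑ k, h k (x k) - h j (x j) + h j t := by
  rw [← Finset.add_sum_erase _ _ (Finset.mem_univ j),
    ← Finset.add_sum_erase _ (fun k => h k (x k)) (Finset.mem_univ j),
    Finset.sum_congr rfl fun k hk => by rw [Function.update_of_ne (Finset.ne_of_mem_erase hk)]]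
  simp only [Function.update_self]
  ring

theorem update_pos {n : ℕ} {x : Fin n → ℝ} (hx : ∀ k, 0 < x k) (j : Fin n) {t : ℝ} (ht : 0 < t)
    (k : Fin n) : 0 < Function.update x j t k := by
  rcases eq_or_ne k j with rfl | hk
  · simpa using ht
  · simpa [Function.update_of_ne hk] using hx k

/-- Every value near a value of a separable sum is attained by varying a single coordinate. -/
theorem eventually_exists_sum_update_eq {n : ℕ} {h : Fin n → ℝ → ℝ} {j : Fin n}
    (hc : ContinuousOn (h j) (Set.Ioi 0))
    (hm : StrictMonoOn (h j) (Set.Ioi 0) ∨ StrictAntiOn (h j) (Set.Ioi 0))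
    {x : Fin n → ℝ} (hx : ∀ k, 0 < x k) :
    ∀ᶠ u in nhds (∑ k, h k (x k)), ∃ t, 0 < t ∧ ∑ k, h k (Function.update x j t k) = u := by
  have hlim : Filter.Tendsto (fun u => u - ∑ k, h k (x k) + h j (x j))
      (nhds (∑ k, h k (x k))) (nhds (h j (x j))) := by
    have : Continuous fun u => u - ∑ k, h k (x k) + h j (x j) := by fun_prop
    simpa using this.tendsto (∑ k, h k (x k))
  filter_upwards [hlim (image_Ioi_mem_nhds hc hm (hx j))]
  rintro u ⟨t, ht, htu⟩
  refine ⟨t, ht, ?_⟩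
  rw [sum_apply_update, htu]
  ring

theorem pd_quasiSum {n : ℕ} {G : ℝ → ℝ} {h : Fin n → ℝ → ℝ} {f : (Fin n → ℝ) → ℝ}
    (hf : ∀ x : Fin n → ℝ, (∀ j, 0 < x j) → f x = G (∑ j, h j (x j)))
    (hG : Differentiable ℝ G) {i : Fin n} {x : Fin n → ℝ} (hx : ∀ j, 0 < x j)
    (hh : DifferentiableAt ℝ (h i) (x i)) :
    pd f i x = deriv G (∑ j, h j (x j)) * deriv (h i) (x i) := by
  have heq : (fun t => f (Function.update x i t)) =ᶠ[nhds (x i)]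
      fun t => G (∑ k, h k (x k) - h i (x i) + h i t) := by
    filter_upwards [Ioi_mem_nhds (hx i)] with t ht
    rw [hf _ (update_pos hx i ht), sum_apply_update]
  rw [pd, heq.deriv_eq]
  refine (HasDerivAt.comp (x i) ?_ (hh.hasDerivAt.const_add _)).deriv
  simpa using (hG (∑ k, h k (x k))).hasDerivAt

/-- A positive function with constant logarithmic derivative on an open preconnected set is a
multiple of an exponential there. -/
theorem exists_eq_mul_exp_of_logDeriv_const {G : ℝ → ℝ} {U : Set ℝ} (hU : IsOpen U)
    (hU' : IsPreconnected U) (hG : Differentiable ℝ G) {D : ℝ}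
    (hD : ∀ u ∈ U, deriv G u = D * G u) : ∃ C, ∀ u ∈ U, G u = C * Real.exp (D * u) := by
  have hder : ∀ u, HasDerivAt (fun u => G u * Real.exp (-(D * u)))
      (deriv G u * Real.exp (-(D * u)) + G u * (Real.exp (-(D * u)) * -(D * 1))) u := fun u =>
    (hG u).hasDerivAt.mul (((hasDerivAt_id u).const_mul D).neg.exp)
  obtain ⟨C, hC⟩ := hU.exists_is_const_of_deriv_eq_zero hU'
    (fun u _ => (hder u).differentiableAt.differentiableWithinAt) (fun u hu => by
      rw [(hder u).deriv, hD u hu]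
      simp only [Pi.zero_apply]
      ring)
  refine ⟨C, fun u hu => ?_⟩
  rw [← hC u hu, mul_assoc, ← Real.exp_add]
  simp

/-- If a quasi-sum production function has nonzero constant elasticity of production `kᵢ`
with respect to some factor `xᵢ`, then `G(u) = C·e^{D·u}` with constants `C, D > 0`
on the range of `u = h₁(x₁)+⋯+hₙ(xₙ)`. -/
theorem quasiSum_constant_elasticity_outer_exp
    (n : ℕ) (hn : 2 ≤ n)
    (G : ℝ → ℝ) (h : Fin n → ℝ → ℝ) (f : (Fin n → ℝ) → ℝ)
    (hf : ∀ x : Fin n → ℝ, (∀ j, 0 < x j) → f x = G (∑ j, h j (x j)))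
    (hfpos : ∀ x : Fin n → ℝ, (∀ j, 0 < x j) → 0 < f x)
    (hGdiff : Differentiable ℝ G)
    (hGdiff2 : Differentiable ℝ (deriv G))
    (hGmono : StrictMono G)
    (hG' : ∀ u : ℝ, 0 < deriv G u)
    (hhdiff : ∀ j, ∀ t : ℝ, 0 < t → DifferentiableAt ℝ (h j) t)
    (hhdiff2 : ∀ j, ∀ t : ℝ, 0 < t → DifferentiableAt ℝ (deriv (h j)) t)
    (hhmono : ∀ j, StrictMonoOn (h j) (Set.Ioi 0) ∨ StrictAntiOn (h j) (Set.Ioi 0))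
    (i : Fin n) (ki : ℝ) (hki : ki ≠ 0)
    (helas : ∀ x : Fin n → ℝ, (∀ j, 0 < x j) → (x i / f x) * pd f i x = ki) :
    ∃ C D : ℝ, 0 < C ∧ 0 < D ∧ ∀ x : Fin n → ℝ, (∀ j, 0 < x j) →
      G (∑ j, h j (x j)) = C * Real.exp (D * ∑ j, h j (x j)) := by
  have hc : ∀ j, ContinuousOn (h j) (Set.Ioi 0) := fun j t ht =>
    (hhdiff j t ht).continuousAt.continuousWithinAt
  obtain ⟨j, hji⟩ : ∃ j : Fin n, j ≠ i :=
    haveI : Nontrivial (Fin n) := Fin.nontrivial_iff_two_le.mpr hn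
    exists_ne i
  set S : (Fin n → ℝ) → ℝ := fun x => ∑ j, h j (x j)
  set P : Set (Fin n → ℝ) := Set.pi Set.univ fun _ => Set.Ioi 0 with hP
  have hmemP : ∀ x, x ∈ P ↔ ∀ k, 0 < x k := by simp [hP]
  have hGpos : ∀ x, (∀ k, 0 < x k) → 0 < G (S x) := fun x hx => hf x hx ▸ hfpos x hx
  have hSP : ContinuousOn S P := continuousOn_finsetSum _ fun k _ =>
    (hc k).comp (continuous_apply k).continuousOn fun x hx => hx k trivial
  have hUconn : IsPreconnected (S '' P) :=
    (convex_pi fun _ _ => convex_Ioi 0).isPreconnected.image S hSP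
  have hUopen : IsOpen (S '' P) := by
    rw [isOpen_iff_mem_nhds]
    rintro _ ⟨x, hx, rfl⟩
    rw [hmemP] at hx
    filter_upwards [eventually_exists_sum_update_eq (hc j) (hhmono j) hx]
    rintro u ⟨t, ht, rfl⟩
    exact ⟨_, (hmemP _).2 (update_pos hx j ht), rfl⟩
  have hlog : ∀ x, (∀ k, 0 < x k) →
      deriv G (S x) / G (S x) * (x i * deriv (h i) (x i)) = ki := fun x hx => by
    rw [← helas x hx, pd_quasiSum hf hGdiff hx (hhdiff i _ (hx i)), hf x hx]
    ring
  have hloc : ∀ x, (∀ k, 0 < x k) →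
      (fun u => deriv G u / G u) =ᶠ[nhds (S x)] fun _ => deriv G (S x) / G (S x) := by
    intro x hx
    filter_upwards [eventually_exists_sum_update_eq (hc j) (hhmono j) hx]
    rintro u ⟨t, ht, rfl⟩
    have h1 := hlog x hx
    have h2 := hlog _ (update_pos hx j ht)
    rw [Function.update_of_ne hji.symm, ← h1] at h2
    exact mul_right_cancel₀ (right_ne_zero_of_mul (h1.trans_ne hki)) h2
  obtain ⟨D, hD⟩ := hUopen.exists_is_const_of_deriv_eq_zero hUconn
    (f := fun u => deriv G u / G u)
    (by
      rintro _ ⟨x, hx, rfl⟩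
      exact ((hloc x ((hmemP x).1 hx)).differentiableAt_iff.2
        (differentiableAt_const _)).differentiableWithinAt)
    (by
      rintro _ ⟨x, hx, rfl⟩
      rw [(hloc x ((hmemP x).1 hx)).deriv_eq]
      simp)
  obtain ⟨C, hC⟩ := exists_eq_mul_exp_of_logDeriv_const hUopen hUconn hGdiff (D := D) (by
    rintro _ ⟨x, hx, rfl⟩
    rw [← hD _ ⟨x, hx, rfl⟩, div_mul_cancel₀ _ (hGpos x ((hmemP x).1 hx)).ne'])
  have hone : ∀ k : Fin n, 0 < (fun _ => 1 : Fin n → ℝ) k := fun _ => one_pos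
  have hmem : S (fun _ => 1) ∈ S '' P := ⟨_, (hmemP _).2 hone, rfl⟩
  refine ⟨C, D, ?_, ?_, fun x hx => hC _ ⟨x, (hmemP x).2 hx, rfl⟩⟩
  · exact pos_of_mul_pos_left (hC _ hmem ▸ hGpos _ hone) (Real.exp_pos _).le
  · rw [← hD _ hmem]
    exact div_pos (hG' _) (hGpos _ hone)
end

section
/- Let n ≥ 2, let k be a nonzero real number, let G be a twice differentiable strictly monotone real function with G' > 0, and suppose h_i(t) = k·ln t + C_i for constants C_i, i = 1,…,n. Let f(x) = G(h_1(x_1)+…+h_n(x_n)) on ℝ_{>0}^n. Then (∂²f/∂x_i²)(∂²f/∂x_j²) − (∂²f/∂x_i∂x_j)² = 0 holds identically for some (equivalently all) pair i ≠ j if and only if G''(u)/G'(u) = 1/(2k) on the relevant range, in which case G(u) = 2kC·e^{u/(2k)} + D for some constants C > 0 and D ∈ ℝ. -/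
/-- Second partial derivative `∂²f/∂xⱼ∂xᵢ` at `x`. -/
noncomputable def pd2 {n : ℕ} (f : (Fin n → ℝ) → ℝ) (i j : Fin n) (x : Fin n → ℝ) : ℝ :=
  pd (pd f i) j x

open Filter Topology in
lemma eventually_update_pos {n : ℕ} {x : Fin n → ℝ} (hx : ∀ l, 0 < x l) (i : Fin n) :
    ∀ᶠ t in 𝓝 (x i), ∀ l, 0 < Function.update x i t l := by
  filter_upwards [lt_mem_nhds (hx i)] with t ht l
  rcases eq_or_ne l i with rfl | hl
  · simpa using ht
  · simpa [hl] using hx l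

/-- Partial derivatives at a point of the open positive orthant depend only on the values there. -/
lemma pd_congr_of_pos {n : ℕ} {f g : (Fin n → ℝ) → ℝ}
    (hfg : ∀ x : Fin n → ℝ, (∀ l, 0 < x l) → f x = g x) {x : Fin n → ℝ}
    (hx : ∀ l, 0 < x l) (i : Fin n) : pd f i x = pd g i x := by
  apply Filter.EventuallyEq.deriv_eq
  filter_upwards [eventually_update_pos hx i] with t ht
  exact hfg _ ht

lemma hasDerivAt_sum_log_update {n : ℕ} (k : ℝ) (C : Fin n → ℝ) {x : Fin n → ℝ}
    (hx : ∀ l, 0 < x l) (i : Fin n) :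
    HasDerivAt (fun t => ∑ j, (k * Real.log (Function.update x i t j) + C j))
      (k / x i) (x i) := by
  have hterm : ∀ j ∈ Finset.univ, HasDerivAt
      (fun t => k * Real.log (Function.update x i t j) + C j)
      (if j = i then k / x i else 0) (x i) := by
    intro j _
    rcases eq_or_ne j i with rfl | hj
    · simpa [div_eq_mul_inv] using
        ((Real.hasDerivAt_log (hx j).ne').const_mul k).add_const (C j)
    · simpa [hj] using hasDerivAt_const (x i) (k * Real.log (x j) + C j)
  simpa using HasDerivAt.fun_sum hterm

lemma pd_comp_sum_log {n : ℕ} (k : ℝ) (C : Fin n → ℝ) {G : ℝ → ℝ} (hG : Differentiable ℝ G)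
    {x : Fin n → ℝ} (hx : ∀ l, 0 < x l) (i : Fin n) :
    pd (fun y => G (∑ j, (k * Real.log (y j) + C j))) i x =
      deriv G (∑ j, (k * Real.log (x j) + C j)) * (k / x i) := by
  have hS := hasDerivAt_sum_log_update k C hx i
  have hd := (hG (∑ j, (k * Real.log (Function.update x i (x i) j) + C j))).hasDerivAt
  exact (hd.comp (x i) hS).deriv.trans (by simp)

lemma pd2_comp_sum_log {n : ℕ} (k : ℝ) (C : Fin n → ℝ) {G : ℝ → ℝ} (hG : Differentiable ℝ G)
    (hG2 : Differentiable ℝ (deriv G)) {x : Fin n → ℝ} (hx : ∀ l, 0 < x l) (i j : Fin n) :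
    pd2 (fun y => G (∑ l, (k * Real.log (y l) + C l))) i j x =
      deriv (deriv G) (∑ l, (k * Real.log (x l) + C l)) * (k / x j) * (k / x i) +
      deriv G (∑ l, (k * Real.log (x l) + C l)) * (if i = j then -k / x i ^ 2 else 0) := by
  rw [pd2, pd_congr_of_pos (fun y hy => pd_comp_sum_log k C hG hy i) hx j]
  have hS := hasDerivAt_sum_log_update k C hx j
  have hd := (hG2 (∑ l, (k * Real.log (Function.update x j (x j) l) + C l))).hasDerivAt
  have hq : HasDerivAt (fun t => k / Function.update x j t i)
      (if i = j then -k / x i ^ 2 else 0) (x j) := by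
    rcases eq_or_ne i j with rfl | hij
    · simpa [div_eq_mul_inv] using (hasDerivAt_inv (hx i).ne').const_mul k
    · simpa [hij] using hasDerivAt_const (x j) (k / x i)
  refine ((hd.comp (x j) hS).mul hq).deriv.trans ?_
  simp

/-- The solutions of `G'' = G' / (2k)` with `G' > 0`. -/
lemma exists_eq_exp_of_deriv_deriv {k : ℝ} (hk : k ≠ 0) {G : ℝ → ℝ}
    (hG : Differentiable ℝ G) (hG2 : Differentiable ℝ (deriv G)) (hG' : ∀ u, 0 < deriv G u)
    (hode : ∀ u, deriv (deriv G) u / deriv G u = 1 / (2 * k)) :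
    ∃ c d : ℝ, 0 < c ∧ ∀ u, G u = 2 * k * c * Real.exp (u / (2 * k)) + d := by
  have hexp : ∀ u : ℝ, HasDerivAt (fun u => Real.exp (u / (2 * k)))
      (Real.exp (u / (2 * k)) * (1 / (2 * k))) u :=
    fun u => ((hasDerivAt_id u).div_const (2 * k)).exp
  have hquot : ∀ u, HasDerivAt (fun u => deriv G u / Real.exp (u / (2 * k))) 0 u := by
    intro u
    refine ((hG2 u).hasDerivAt.fun_div (hexp u) (Real.exp_pos _).ne').congr_deriv ?_
    rw [(div_eq_iff (hG' u).ne').mp (hode u)]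
    ring
  have hG'eq : ∀ u, deriv G u = deriv G 0 * Real.exp (u / (2 * k)) := by
    intro u
    have := is_const_of_deriv_eq_zero (fun v => (hquot v).differentiableAt)
      (fun v => (hquot v).deriv) u 0
    rw [← div_eq_iff (Real.exp_pos _).ne']
    simpa using this
  have hdiff : ∀ u, HasDerivAt
      (fun u => G u - 2 * k * deriv G 0 * Real.exp (u / (2 * k))) 0 u := by
    intro u
    refine ((hG u).hasDerivAt.fun_sub ((hexp u).const_mul (2 * k * deriv G 0))).congr_deriv ?_
    rw [hG'eq u]
    field_simp
    ring
  refine ⟨deriv G 0, G 0 - 2 * k * deriv G 0, hG' 0, fun u => ?_⟩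
  have := is_const_of_deriv_eq_zero (fun v => (hdiff v).differentiableAt)
    (fun v => (hdiff v).deriv) u 0
  simp only [zero_div, Real.exp_zero, mul_one] at this
  linarith

/-- For `f(x) = G(∑ᵢ (k·ln xᵢ + Cᵢ))` with `k ≠ 0` and `G' > 0`, the identity
`f_{xᵢxᵢ}f_{xⱼxⱼ} − f_{xᵢxⱼ}² = 0` holds for some (equivalently all) pair `i ≠ j`
iff `G''/G' = 1/(2k)` on the relevant range, in which case
`G(u) = 2kC·e^{u/(2k)} + D` with `C > 0`. -/
theorem sectional_vanishes_iff_ode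
    (n : ℕ) (hn : 2 ≤ n) (k : ℝ) (hk : k ≠ 0)
    (G : ℝ → ℝ) (C : Fin n → ℝ) (h : Fin n → ℝ → ℝ)
    (hh : ∀ i : Fin n, ∀ t : ℝ, 0 < t → h i t = k * Real.log t + C i)
    (f : (Fin n → ℝ) → ℝ)
    (hf : ∀ x : Fin n → ℝ, (∀ j, 0 < x j) → f x = G (∑ j, h j (x j)))
    (hGdiff : Differentiable ℝ G)
    (hGdiff2 : Differentiable ℝ (deriv G))
    (hGmono : StrictMono G)
    (hG' : ∀ u : ℝ, 0 < deriv G u) :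
    ((∃ i j : Fin n, i ≠ j ∧ ∀ x : Fin n → ℝ, (∀ l, 0 < x l) →
        pd2 f i i x * pd2 f j j x - (pd2 f i j x) ^ 2 = 0)
      ↔ (∀ x : Fin n → ℝ, (∀ l, 0 < x l) →
          deriv (deriv G) (∑ j, h j (x j)) / deriv G (∑ j, h j (x j)) = 1 / (2 * k)))
    ∧ ((∀ i j : Fin n, i ≠ j → ∀ x : Fin n → ℝ, (∀ l, 0 < x l) →
        pd2 f i i x * pd2 f j j x - (pd2 f i j x) ^ 2 = 0)
      ↔ (∀ x : Fin n → ℝ, (∀ l, 0 < x l) →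
          deriv (deriv G) (∑ j, h j (x j)) / deriv G (∑ j, h j (x j)) = 1 / (2 * k)))
    ∧ ((∀ x : Fin n → ℝ, (∀ l, 0 < x l) →
          deriv (deriv G) (∑ j, h j (x j)) / deriv G (∑ j, h j (x j)) = 1 / (2 * k)) →
        ∃ c d : ℝ, 0 < c ∧ ∀ x : Fin n → ℝ, (∀ l, 0 < x l) →
          G (∑ j, h j (x j)) = 2 * k * c * Real.exp ((∑ j, h j (x j)) / (2 * k)) + d) := by
  have hsum : ∀ x : Fin n → ℝ, (∀ l, 0 < x l) →
      ∑ j, h j (x j) = ∑ j, (k * Real.log (x j) + C j) :=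
    fun x hx => Finset.sum_congr rfl fun j _ => hh j _ (hx j)
  have hf' : ∀ x : Fin n → ℝ, (∀ l, 0 < x l) →
      f x = G (∑ j, (k * Real.log (x j) + C j)) :=
    fun x hx => by rw [hf x hx, hsum x hx]
  have hpd2 : ∀ (i j : Fin n) (x : Fin n → ℝ), (∀ l, 0 < x l) → pd2 f i j x =
      deriv (deriv G) (∑ l, h l (x l)) * (k / x j) * (k / x i) +
      deriv G (∑ l, h l (x l)) * (if i = j then -k / x i ^ 2 else 0) := by
    intro i j x hx
    rw [hsum x hx, ← pd2_comp_sum_log k C hGdiff hGdiff2 hx i j]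
    exact pd_congr_of_pos (fun y hy => pd_congr_of_pos hf' hy i) hx j
  have key : ∀ i j : Fin n, i ≠ j → ∀ x : Fin n → ℝ, (∀ l, 0 < x l) →
      (pd2 f i i x * pd2 f j j x - (pd2 f i j x) ^ 2 = 0 ↔
        deriv (deriv G) (∑ j, h j (x j)) / deriv G (∑ j, h j (x j)) = 1 / (2 * k)) := by
    intro i j hij x hx
    rw [hpd2 i i x hx, hpd2 j j x hx, hpd2 i j x hx, if_pos rfl, if_pos rfl, if_neg hij]
    have ha := hG' (∑ j, h j (x j))
    generalize deriv G (∑ j, h j (x j)) = a at ha ⊢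
    generalize deriv (deriv G) (∑ j, h j (x j)) = b
    have hi := (hx i).ne'
    have hj := (hx j).ne'
    have hfactor : (b * (k / x i) * (k / x i) + a * (-k / x i ^ 2)) *
        (b * (k / x j) * (k / x j) + a * (-k / x j ^ 2)) -
        (b * (k / x j) * (k / x i) + a * 0) ^ 2 =
        k ^ 2 * a / (x i ^ 2 * x j ^ 2) * (a - b * (2 * k)) := by
      field_simp
      ring
    have hcoef : k ^ 2 * a / (x i ^ 2 * x j ^ 2) ≠ 0 := by positivity
    rw [hfactor, mul_eq_zero_iff_left hcoef, div_eq_div_iff ha.ne' (by positivity), sub_eq_zero,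
      one_mul, eq_comm]
  have hn0 : (n : ℝ) ≠ 0 := by
    have : n ≠ 0 := by omega
    exact_mod_cast this
  refine ⟨⟨?_, fun H => ?_⟩, ⟨fun H => ?_, fun H i j hij x hx => (key i j hij x hx).2 (H x hx)⟩,
    fun H => ?_⟩
  · rintro ⟨i, j, hij, H⟩ x hx
    exact (key i j hij x hx).1 (H x hx)
  · have hij : (⟨0, by omega⟩ : Fin n) ≠ ⟨1, by omega⟩ := by simp
    exact ⟨_, _, hij, fun x hx => (key _ _ hij x hx).2 (H x hx)⟩
  · have hij : (⟨0, by omega⟩ : Fin n) ≠ ⟨1, by omega⟩ := by simp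
    exact fun x hx => (key _ _ hij x hx).1 (H _ _ hij x hx)
  · have hode : ∀ u, deriv (deriv G) u / deriv G u = 1 / (2 * k) := by
      intro u
      have hpos : ∀ l, 0 < Real.exp ((u / n - C l) / k) := fun l => Real.exp_pos _
      have hu := H _ hpos
      rw [hsum _ hpos] at hu
      simpa [mul_div_cancel₀, mul_div_cancel_left₀, hk, hn0] using hu
    obtain ⟨c, d, hc, hG⟩ := exists_eq_exp_of_deriv_deriv hk hGdiff hGdiff2 hG' hode
    exact ⟨c, d, hc, fun x _ => hG _⟩
end
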